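/- arXiv:2007.13309 — 5 statements merged into one kernel-verified Lean document; each statement's English description precedes it below -/
import Mathlib

section
/- Let q be a prime power, m ≥ 2 an even integer, and r = q+1. For every integer δ ≥ 2, the set T_δ = ∪_{i=0}^{δ−2} C_{1+r·i} satisfies T_δ ∩ T_δ^{−q} = ∅ if and only if 2 ≤ δ ≤ δ^max. (Equivalently, the narrow-sense constacyclic BCH code of length n = (q^{2m}−1)/(q+1) with defining set T_δ is Hermitian dual-containing if and only if 2 ≤ δ ≤ δ^max.) -/
/-- The q²-cyclotomic coset of `s` modulo `M`, viewed inside `ZMod M`. -/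
def coset (q M s : ℕ) : Set (ZMod M) :=
  {x | ∃ l : ℕ, x = (s : ZMod M) * (q : ZMod M) ^ (2 * l)}

/-- The maximum design distance `δ^max`. -/
def deltaMax (q m : ℕ) : ℕ :=
  if m = 2 ∧ 5 ≤ q then (q ^ 3 - q ^ 2 + q + 3) / (q + 1) + 1
  else (q ^ (m + 1) - q ^ 2 + q + 3) / (q + 1)

/-- The defining set `T_δ = ∪_{i=0}^{δ−2} C_{1+r·i}` inside `ZMod (q^{2m}−1)`. -/
def Tset (q m r δ : ℕ) : Set (ZMod (q ^ (2 * m) - 1)) :=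
  ⋃ i ∈ Finset.range (δ - 1), coset q (q ^ (2 * m) - 1) (1 + r * i)

/-- `T_δ^{−q} = { −q·j : j ∈ T_δ }` inside `ZMod (q^{2m}−1)`. -/
def TsetNegQ (q m r δ : ℕ) : Set (ZMod (q ^ (2 * m) - 1)) :=
  (fun x => -(q : ZMod (q ^ (2 * m) - 1)) * x) '' Tset q m r δ

/-- The quotient `(q^{m+1} − q² + q + 3)/(q + 1)` is exact for even `m`. -/
lemma succ_mul_div_eq {q m : ℕ} (hq : 2 ≤ q) (hm : 2 ≤ m) (hme : Even m) :
    (q + 1) * ((q ^ (m + 1) - q ^ 2 + q + 3) / (q + 1)) + q ^ 2 =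
      q ^ (m - 1) * q ^ 2 + q + 3 := by
  have hodd : Odd (m - 1) := Nat.Even.sub_odd (by omega) hme odd_one
  obtain ⟨c, hc⟩ : q + 1 ∣ q ^ (m - 1) + 1 := by
    simpa using hodd.nat_add_dvd_pow_add_pow q 1
  have hpow : q ^ (m + 1) = q ^ (m - 1) * q ^ 2 := by
    rw [← pow_add]; congr 1; omega
  have hle : q ^ 2 ≤ q ^ (m + 1) := Nat.pow_le_pow_right (by omega) (by omega)
  have hdvd : q + 1 ∣ q ^ (m + 1) - q ^ 2 + q + 3 := by
    zify [hle]
    refine ⟨c * q ^ 2 - 2 * q + 3, ?_⟩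
    zify at hc hpow
    rw [hpow]
    linear_combination (q : ℤ) ^ 2 * hc
  rw [Nat.mul_div_cancel' hdvd, ← hpow]
  omega

lemma succ_mul_deltaMax_of_two {q : ℕ} (hq : 5 ≤ q) :
    (q + 1) * deltaMax q 2 + q ^ 2 = q ^ 3 + 2 * q + 4 := by
  have h := succ_mul_div_eq (q := q) (m := 2) (by omega) le_rfl even_two
  rw [deltaMax, if_pos ⟨rfl, hq⟩]
  norm_num at h ⊢
  linear_combination h

lemma succ_mul_deltaMax_of_not {q m : ℕ} (hq : 2 ≤ q) (hm : 2 ≤ m) (hme : Even m)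
    (h : ¬(m = 2 ∧ 5 ≤ q)) :
    (q + 1) * deltaMax q m + q ^ 2 = q ^ (m - 1) * q ^ 2 + q + 3 := by
  rw [deltaMax, if_neg h, succ_mul_div_eq hq hm hme]

lemma pow_two_mul_eq {q m : ℕ} (hm : 2 ≤ m) :
    q ^ (2 * m) = q ^ (m - 1) * q ^ (m - 1) * q ^ 2 := by
  rw [← pow_add, ← pow_add]; congr 1; omega

lemma mul_pow_add_one_lt {q m a : ℕ} (hq : 2 ≤ q) (hm : 2 ≤ m) (hme : Even m)
    (ha : a + 2 ≤ deltaMax q m) :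
    (1 + (q + 1) * a) * (q ^ (m - 1) + 1) + 1 < q ^ (2 * m) := by
  rw [pow_two_mul_eq hm]
  have hmul : (q + 1) * (a + 2) ≤ (q + 1) * deltaMax q m := Nat.mul_le_mul_left _ ha
  by_cases h : m = 2 ∧ 5 ≤ q
  · obtain ⟨rfl, h5⟩ := h
    have hd := succ_mul_deltaMax_of_two h5
    have hx : 1 + (q + 1) * a + q ^ 2 ≤ q ^ 3 + 3 := by linarith
    have := Nat.mul_le_mul_right (q + 1) hx
    norm_num
    nlinarith
  · have hd := succ_mul_deltaMax_of_not hq hm hme h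
    set p := q ^ (m - 1) with hp
    have hx : 1 + (q + 1) * a + q ^ 2 + q ≤ p * q ^ 2 + 2 := by linarith
    have := Nat.mul_le_mul_right (p + 1) hx
    have := Nat.mul_le_mul_left p hq
    nlinarith

/-- At `a = δ^max − 1` the complement of `(1 + (q + 1)a) q^{m−1}` in `q^{2m} − 1` is an
element `1 + (q + 1)b` with `b ≤ a`. -/
lemma exists_mul_pow_add_eq {q m : ℕ} (hq : 2 ≤ q) (hm : 2 ≤ m) (hme : Even m) :
    ∃ b < deltaMax q m, (1 + (q + 1) * (deltaMax q m - 1)) * q ^ (m - 1) +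
      (1 + (q + 1) * b) + 1 = q ^ (2 * m) := by
  have hodd : Odd (m - 1) := Nat.Even.sub_odd (by omega) hme odd_one
  have hsq : 2 * q ≤ q ^ 2 := by nlinarith
  have hp : q ≤ q ^ (m - 1) := Nat.le_self_pow (by omega) q
  obtain ⟨x, hx⟩ : ∃ x, x = 1 + (q + 1) * (deltaMax q m - 1) := ⟨_, rfl⟩
  have hpos : 0 < deltaMax q m := by
    rw [Nat.pos_iff_ne_zero]
    intro h0
    by_cases h : m = 2 ∧ 5 ≤ q
    · obtain ⟨rfl, h5⟩ := h
      have hd := succ_mul_deltaMax_of_two h5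
      rw [h0] at hd
      nlinarith
    · have hd := succ_mul_deltaMax_of_not hq hm hme h
      rw [h0] at hd
      nlinarith
  have hxd : x + q = (q + 1) * deltaMax q m := by
    obtain ⟨k, hk⟩ := Nat.exists_eq_add_of_lt hpos
    rw [hx, hk]
    simp
    ring
  obtain ⟨y, hy0, hyx, hxy⟩ :
      ∃ y, 1 ≤ y ∧ y ≤ x ∧ x * q ^ (m - 1) + y + 1 = q ^ (2 * m) := by
    rw [pow_two_mul_eq hm]
    by_cases h : m = 2 ∧ 5 ≤ q
    · obtain ⟨rfl, h5⟩ := h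
      have hd := succ_mul_deltaMax_of_two h5
      have hxe : (x : ℤ) = q ^ 3 - q ^ 2 + q + 4 := by zify at hxd hd; linarith
      have h5' : (5 : ℤ) ≤ q := by exact_mod_cast h5
      have hy : (1 : ℤ) ≤ q ^ 3 - q ^ 2 - 4 * q - 1 := by
        nlinarith [mul_nonneg (sub_nonneg.2 h5') (sq_nonneg (q : ℤ))]
      obtain ⟨y, hye⟩ := Int.eq_ofNat_of_zero_le (by linarith :
        (0 : ℤ) ≤ q ^ 3 - q ^ 2 - 4 * q - 1)
      refine ⟨y, ?_, ?_, ?_⟩ <;> zify <;> rw [← hye]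
      · exact hy
      · linarith
      · norm_num [hxe]; ring
    · have hd := succ_mul_deltaMax_of_not hq hm hme h
      have hbig : q ^ 2 ≤ 3 * q ^ (m - 1) + 4 := by
        by_cases h2 : m = 2
        · subst h2
          have : q ≤ 4 := by omega
          norm_num
          nlinarith
        · have := Nat.pow_le_pow_right (show 0 < q by omega) (show 2 ≤ m - 1 by omega)
          omega
      set p := q ^ (m - 1)
      have hxe : (x : ℤ) = p * q ^ 2 - q ^ 2 + 3 := by zify at hxd hd; linarith
      zify at hbig hq hp
      have hy : (1 : ℤ) ≤ p * q ^ 2 - 3 * p - 1 := by nlinarith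
      obtain ⟨y, hye⟩ := Int.eq_ofNat_of_zero_le (by linarith :
        (0 : ℤ) ≤ p * q ^ 2 - 3 * p - 1)
      refine ⟨y, ?_, ?_, ?_⟩ <;> zify <;> rw [← hye]
      · exact hy
      · linarith
      · rw [hxe]; ring
  obtain ⟨b, hb⟩ : q + 1 ∣ y - 1 := by
    obtain ⟨c, hc⟩ : q + 1 ∣ q ^ (m - 1) + 1 := by
      simpa using hodd.nat_add_dvd_pow_add_pow q 1
    rw [pow_two_mul_eq hm] at hxy
    zify [hy0]
    zify at hc hxy hxd
    refine ⟨(q ^ (m - 1) * q + 2) * (c * q - 1) - q ^ (m - 1) * deltaMax q m, ?_⟩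
    linear_combination hxy - (q : ℤ) ^ (m - 1) * hxd + ((q : ℤ) ^ (m - 1) * q + 2) * q * hc
  have hyb : y = 1 + (q + 1) * b := by omega
  refine ⟨b, ?_, by rw [← hx, ← hyb]; exact hxy⟩
  by_contra hle
  have := Nat.mul_le_mul_left (q + 1) (not_lt.1 hle)
  omega

lemma mem_Tset {q m r δ : ℕ} {z : ZMod (q ^ (2 * m) - 1)} :
    z ∈ Tset q m r δ ↔ ∃ i < δ - 1, ∃ l : ℕ,
      z = ((1 + r * i : ℕ) : ZMod (q ^ (2 * m) - 1)) * (q : ZMod _) ^ (2 * l) := by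
  simp [Tset, coset]

lemma natCast_pow_two_mul_eq_one {q m : ℕ} (hq : 2 ≤ q) :
    (q : ZMod (q ^ (2 * m) - 1)) ^ (2 * m) = 1 := by
  have h : ((q ^ (2 * m) - 1 : ℕ) : ZMod (q ^ (2 * m) - 1)) = 0 := ZMod.natCast_self _
  rw [Nat.cast_sub (Nat.one_le_pow _ _ (by omega))] at h
  push_cast at h
  exact sub_eq_zero.1 h

lemma exists_odd_pow_of_mul_pow_eq {R : Type*} [CommRing R] {u x y : R} {m a b : ℕ}
    (hm : 2 ≤ m) (hu : u ^ (2 * m) = 1)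
    (h : x * u ^ (2 * a) = -u * (y * u ^ (2 * b))) :
    ∃ e < 2 * m, Odd e ∧ x * u ^ e = -y := by
  have hE : 1 + 2 * b ≤ 2 * m * (b + 1) := by nlinarith
  obtain ⟨k, hk⟩ := Nat.exists_eq_add_of_le hE
  refine ⟨(2 * a + k) % (2 * m), Nat.mod_lt _ (by omega), ?_, ?_⟩
  · rw [Nat.odd_iff, Nat.mod_mul_right_mod]
    have : (2 * m * (b + 1)) % 2 = 0 := by rw [mul_assoc]; exact Nat.mul_mod_right _ _
    omega
  · have hone : u ^ (1 + 2 * b + k) = 1 := by rw [← hk, pow_mul, hu, one_pow]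
    rw [← pow_eq_pow_mod _ hu]
    calc x * u ^ (2 * a + k) = x * u ^ (2 * a) * u ^ k := by ring
      _ = -y * u ^ (1 + 2 * b + k) := by rw [h]; ring
      _ = -y := by rw [hone, mul_one]

lemma natCast_mul_pow_ne_neg {q m d i j e : ℕ} (hq : 2 ≤ q) (hm : 2 ≤ m) (hme : Even m)
    (hd : d + 2 ≤ deltaMax q m) (hi : i ≤ d) (hj : j ≤ d) (he : e ≤ m - 1) :
    ((1 + (q + 1) * i : ℕ) : ZMod (q ^ (2 * m) - 1)) * (q : ZMod _) ^ e ≠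
      -((1 + (q + 1) * j : ℕ) : ZMod (q ^ (2 * m) - 1)) := by
  intro h
  rw [← sub_eq_zero, sub_neg_eq_add, ← Nat.cast_pow, ← Nat.cast_mul, ← Nat.cast_add,
    ZMod.natCast_eq_zero_iff] at h
  have hle := Nat.le_of_dvd (by omega) h
  have hlt := mul_pow_add_one_lt hq hm hme hd
  have hpe : q ^ e ≤ q ^ (m - 1) := Nat.pow_le_pow_right (by omega) he
  have hx : 1 + (q + 1) * i ≤ 1 + (q + 1) * d := by gcongr
  have hy : 1 + (q + 1) * j ≤ 1 + (q + 1) * d := by gcongr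
  have := Nat.mul_le_mul hx hpe
  rw [mul_add, mul_one] at hlt
  omega

theorem stmt0 (q m : ℕ) (hq : IsPrimePow q) (hm : 2 ≤ m) (hme : Even m)
    (r : ℕ) (hr : r = q + 1) (δ : ℕ) (hδ : 2 ≤ δ) :
    Tset q m r δ ∩ TsetNegQ q m r δ = ∅ ↔ 2 ≤ δ ∧ δ ≤ deltaMax q m := by
  subst hr
  have hq2 : 2 ≤ q := hq.two_le
  have hu := natCast_pow_two_mul_eq_one (m := m) hq2
  rw [Set.eq_empty_iff_forall_notMem]
  constructor
  · refine fun hempty => ⟨hδ, not_lt.1 fun hlt => ?_⟩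
    obtain ⟨b, hb, hsum⟩ := exists_mul_pow_add_eq hq2 hm hme
    obtain ⟨k, hk⟩ := hme
    have hzero : (((1 + (q + 1) * (deltaMax q m - 1)) * q ^ (m - 1) + (1 + (q + 1) * b) : ℕ) :
        ZMod (q ^ (2 * m) - 1)) = 0 := by
      rw [ZMod.natCast_eq_zero_iff, ← hsum, Nat.add_sub_cancel]
    rw [Nat.cast_add, Nat.cast_mul, Nat.cast_pow] at hzero
    refine hempty (-q * ((1 + (q + 1) * b : ℕ) : ZMod (q ^ (2 * m) - 1))) ⟨?_, ?_⟩
    · refine mem_Tset.2 ⟨deltaMax q m - 1, by omega, k, ?_⟩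
      rw [show 2 * k = m - 1 + 1 by omega, pow_succ]
      linear_combination -(q : ZMod (q ^ (2 * m) - 1)) * hzero
    · exact ⟨_, mem_Tset.2 ⟨b, by omega, 0, by simp⟩, rfl⟩
  · rintro ⟨-, hle⟩ z ⟨hz, w, hw, hwz⟩
    obtain ⟨i, hi, a, rfl⟩ := mem_Tset.1 hz
    obtain ⟨j, hj, b, rfl⟩ := mem_Tset.1 hw
    obtain ⟨e, he, hodd, hxy⟩ := exists_odd_pow_of_mul_pow_eq hm hu hwz.symm
    have hd : δ - 2 + 2 ≤ deltaMax q m := by omega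
    rcases Nat.lt_or_ge e m with hem | hem
    · exact natCast_mul_pow_ne_neg hq2 hm hme hd (by omega) (by omega) (by omega) hxy
    · have hne : e ≠ m := fun h => Nat.not_even_iff_odd.2 hodd (h ▸ hme)
      refine natCast_mul_pow_ne_neg (e := 2 * m - e) hq2 hm hme hd
        (show j ≤ δ - 2 by omega) (show i ≤ δ - 2 by omega) (by omega) ?_
      have hone : (q : ZMod (q ^ (2 * m) - 1)) ^ e * (q : ZMod _) ^ (2 * m - e) = 1 := by
        rw [← pow_add, Nat.add_sub_cancel' he.le, hu]
      linear_combination (q : ZMod (q ^ (2 * m) - 1)) ^ (2 * m - e) * hxy -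
        ((1 + (q + 1) * i : ℕ) : ZMod (q ^ (2 * m) - 1)) * hone
end

section
/- Let q be a prime power, m ≥ 2 an even integer, and r = q+1. For every integer i with 0 ≤ i and (q+1)·i ≤ q^{m+1}−2, the cardinality of the q²-cyclotomic coset C_{1+r·i} modulo q^{2m}−1 equals m/2 if q is even, q > 2, and i = i*, and equals m in all other cases. -/
/-- `i* = (⌈(q+1)/2⌉·(q^m+1) − [q even])/(q+1)`. -/
def istar (q m : ℕ) : ℕ :=
  ((q + 2) / 2 * (q ^ m + 1) - if Even q then 1 else 0) / (q + 1)

/-- The number of points in the forward orbit of a periodic point is its minimal period. -/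
theorem ncard_range_iterate {α : Type*} {f : α → α} {x : α}
    (hx : x ∈ Function.periodicPts f) :
    (Set.range fun l : ℕ => f^[l] x).ncard = Function.minimalPeriod f x := by
  have hpos := Function.minimalPeriod_pos_of_mem_periodicPts hx
  have himage : (Set.range fun l : ℕ => f^[l] x) =
      (fun l : ℕ => f^[l] x) '' Set.Iio (Function.minimalPeriod f x) := by
    ext y
    constructor
    · rintro ⟨l, rfl⟩
      exact ⟨l % Function.minimalPeriod f x, Nat.mod_lt _ hpos,
        Function.iterate_mod_minimalPeriod_eq⟩
    · rintro ⟨l, -, rfl⟩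
      exact ⟨l, rfl⟩
  rw [himage, Function.iterate_injOn_Iio_minimalPeriod.ncard_image,
    ← Finset.coe_Iio, Set.ncard_coe_finset, Nat.card_Iio]

theorem iterate_mul_sq {R : Type*} [CommMonoid R] (a x : R) (l : ℕ) :
    (fun y : R => y * a ^ 2)^[l] x = x * a ^ (2 * l) := by
  induction l with
  | zero => simp
  | succ l ih => rw [Function.iterate_succ_apply', ih, mul_assoc, ← pow_add, mul_add_one]

theorem coset_eq_range_iterate (q M s : ℕ) :
    coset q M s =
      Set.range fun l : ℕ => (fun y : ZMod M => y * (q : ZMod M) ^ 2)^[l] (s : ZMod M) := by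
  ext x
  simp only [coset, Set.mem_ofPred_eq, Set.mem_range, iterate_mul_sq, eq_comm]

theorem isPeriodicPt_mul_sq_iff {q : ℕ} (hq : 0 < q) (M s l : ℕ) :
    Function.IsPeriodicPt (fun y : ZMod M => y * (q : ZMod M) ^ 2) l (s : ZMod M) ↔
      M ∣ s * (q ^ (2 * l) - 1) := by
  have hpow : 1 ≤ q ^ (2 * l) := Nat.one_le_pow _ _ hq
  rw [Function.IsPeriodicPt, Function.IsFixedPt, iterate_mul_sq, ← ZMod.natCast_eq_zero_iff]
  push_cast [Nat.cast_sub hpow]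
  rw [mul_sub, mul_one, sub_eq_zero]

/-- A period of a small element that properly divides `m` is `m / 2`. -/
theorem eq_two_mul_of_dvd_mul_pow_sub_one {q m s l : ℕ} (hq : 2 ≤ q) (hm : 0 < m)
    (hs : 0 < s) (hsq : s < q ^ (m + 1)) (hlm : l ∣ m) (hne : l ≠ m)
    (h : q ^ (2 * m) - 1 ∣ s * (q ^ (2 * l) - 1)) : m = 2 * l := by
  obtain ⟨c, rfl⟩ := hlm
  have hl : 0 < l := Nat.pos_of_mul_pos_right hm
  by_contra hc
  have hc3 : 3 ≤ c := by
    by_contra! hlt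
    interval_cases c <;> omega
  have hexp : 2 * l + 1 ≤ l * c := by nlinarith
  have hlow : q ^ (2 * l) ≤ q ^ (l * c - 1) := Nat.pow_le_pow_right (by omega) (by omega)
  have hone : 1 < q ^ (2 * l) := Nat.one_lt_pow (by omega) (by omega)
  have hle := Nat.le_of_dvd (Nat.mul_pos hs (by omega)) h
  have hsplit : q ^ (2 * (l * c)) = q ^ (l * c + 1) * q ^ (l * c - 1) := by
    rw [← pow_add]
    congr 1
    omega
  have hbig : 1 ≤ q ^ (2 * (l * c)) := Nat.one_le_pow _ _ (by omega)
  zify [hone.le, hbig] at *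
  nlinarith

theorem exists_pow_eq_succ_mul_add_one {q m : ℕ} (hq : 0 < q) (hme : Even m) :
    ∃ t, q ^ m = (q + 1) * t + 1 := by
  obtain ⟨k, rfl⟩ := even_iff_two_dvd.mp hme
  have hdvd : q + 1 ∣ q ^ (2 * k) - 1 := by
    have h1 : q ^ 2 - 1 ∣ (q ^ 2) ^ k - 1 ^ k := Nat.sub_dvd_pow_sub_pow _ _ _
    rw [one_pow, ← pow_mul] at h1
    refine dvd_trans ⟨q - 1, ?_⟩ h1
    simpa using Nat.sq_sub_sq q 1
  obtain ⟨t, ht⟩ := hdvd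
  have := Nat.one_le_pow (2 * k) q hq
  exact ⟨t, by omega⟩

theorem pow_add_one_dvd_iff_eq_istar {q m i : ℕ} (hq : 2 ≤ q) (hme : Even m)
    (hi : (q + 1) * i + 2 ≤ q ^ (m + 1)) :
    q ^ m + 1 ∣ 1 + (q + 1) * i ↔ Even q ∧ 2 < q ∧ i = istar q m := by
  obtain ⟨t, ht⟩ := exists_pow_eq_succ_mul_add_one (by omega : 0 < q) hme
  constructor
  · rintro ⟨k, hk⟩
    have hkq : k < q := by
      by_contra! hge
      have := Nat.mul_le_mul_left (q ^ m + 1) hge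
      rw [pow_succ] at hi
      nlinarith
    have hk0 : k ≠ 0 := by
      rintro rfl
      omega
    have hdvd : ((q : ℤ) + 1) ∣ 2 * k - 1 := by
      refine ⟨i - t * k, ?_⟩
      rw [ht] at hk
      zify at hk
      linear_combination -hk
    obtain ⟨c, hc⟩ := hdvd
    have hc1 : c = 1 := by
      have hpos : 0 < c := by
        by_contra! hneg
        have : (1 : ℤ) ≤ k := by omega
        nlinarith
      have hlt : c < 2 := by
        by_contra! hge
        have : (k : ℤ) < q := by omega
        nlinarith
      omega
    rw [hc1, mul_one] at hc
    have hqk : q + 2 = k * 2 := by omega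
    have heven : Even q := even_iff_two_dvd.mpr ⟨k - 1, by omega⟩
    refine ⟨heven, by omega, ?_⟩
    rw [istar, if_pos heven, hqk, Nat.mul_div_cancel _ two_pos, mul_comm k, ← hk,
      Nat.add_sub_cancel_left, Nat.mul_div_cancel_left _ (by omega)]
  · rintro ⟨heven, -, rfl⟩
    obtain ⟨a, rfl⟩ := even_iff_two_dvd.mp heven
    have hstar : istar (2 * a) m = (a + 1) * t + 1 := by
      have hnum : (a + 1) * ((2 * a) ^ m + 1) = (2 * a + 1) * ((a + 1) * t + 1) + 1 := by
        rw [ht]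
        ring
      rw [istar, if_pos heven, show (2 * a + 2) / 2 = a + 1 by omega, hnum,
        Nat.add_sub_cancel, Nat.mul_div_cancel_left _ (by omega)]
    refine ⟨a + 1, ?_⟩
    rw [hstar, ht]
    ring

theorem stmt3 (q m : ℕ) (hq : IsPrimePow q) (hm : 2 ≤ m) (hme : Even m)
    (r : ℕ) (hr : r = q + 1)
    (i : ℕ) (hi : (q + 1) * i ≤ q ^ (m + 1) - 2) :
    (coset q (q ^ (2 * m) - 1) (1 + r * i)).ncard =
      if Even q ∧ 2 < q ∧ i = istar q m then m / 2 else m := by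
  subst hr
  have hq2 : 2 ≤ q := hq.two_le
  have hpow : 2 ≤ q ^ (m + 1) := hq2.trans (Nat.le_self_pow (by omega) q)
  have hi' : (q + 1) * i + 2 ≤ q ^ (m + 1) := by omega
  set s := 1 + (q + 1) * i with hs
  set M := q ^ (2 * m) - 1 with hM
  have hperiod := isPeriodicPt_mul_sq_iff (by omega : 0 < q) M s
  have hperiod_m := (hperiod m).mpr (dvd_mul_left _ _)
  have hmem := Function.mk_mem_periodicPts (by omega) hperiod_m
  obtain ⟨h, hh⟩ := even_iff_two_dvd.mp hme
  have hhalf : M ∣ s * (q ^ (2 * h) - 1) ↔ q ^ m + 1 ∣ s := by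
    have hfac : M = (q ^ m + 1) * (q ^ m - 1) := by
      simpa [hM, ← pow_mul, mul_comm] using Nat.sq_sub_sq (q ^ m) 1
    have h1 : 1 < q ^ m := Nat.one_lt_pow (by omega) (by omega)
    rw [hfac, ← hh]
    exact Nat.mul_dvd_mul_iff_right (by omega)
  rw [coset_eq_range_iterate, ncard_range_iterate hmem]
  set p := Function.minimalPeriod (fun y : ZMod M => y * (q : ZMod M) ^ 2) (s : ZMod M)
  have hp_dvd : p ∣ m := hperiod_m.minimalPeriod_dvd
  have hp_period : M ∣ s * (q ^ (2 * p) - 1) :=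
    (hperiod p).mp (Function.isPeriodicPt_minimalPeriod _ _)
  have hp_eq : p ≠ m → m = 2 * p := fun hne =>
    eq_two_mul_of_dvd_mul_pow_sub_one hq2 (by omega) (by omega) (by omega) hp_dvd hne hp_period
  have hiff := hhalf.trans (pow_add_one_dvd_iff_eq_istar hq2 hme hi')
  split_ifs with hcond
  · have hle : p ≤ h := ((hperiod h).mpr (hiff.mpr hcond)).minimalPeriod_le (by omega)
    have := hp_eq (by omega)
    omega
  · by_contra hne
    have hph : p = h := by
      have := hp_eq hne
      omega
    exact hcond (hiff.mp (hph ▸ hp_period))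
end

section
/- Let q be an even prime power and m ≥ 2 an even integer. Then: (a) if q > 2, then (q+1)·i* ≤ q^{m+1}−2, while for q = 2 one has (q+1)·i* > q^{m+1}−2; (b) i* ≤ δ^max − 2 if and only if (q = 4 and m ≥ 4) or q ≥ 8. -/
theorem exists_pow_eq_succ_mul_add_one_s7 (q n : ℕ) (hq : 1 ≤ q) :
    ∃ j, q ^ (2 * (n + 1)) = (q + 1) * j + 1 ∧ q ≤ j + 1 ∧ (n = 0 → j + 1 = q) ∧
      (1 ≤ n → q * q * (q - 1) ≤ j) := by
  obtain ⟨r, rfl⟩ := Nat.exists_eq_add_of_le' hq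
  induction n with
  | zero => exact ⟨r, by ring, le_rfl, fun _ => rfl, by omega⟩
  | succ n ih =>
    obtain ⟨j, hj, hle, -, -⟩ := ih
    refine ⟨(r + 1) * (r + 1) * j + r, ?_, by nlinarith, by omega, fun _ => ?_⟩
    · rw [show 2 * (n + 1 + 1) = 2 * (n + 1) + 2 by ring, pow_add, hj]
      ring
    · have : r ≤ j := by omega
      have := Nat.mul_le_mul_left ((r + 1) * (r + 1)) this
      simp only [Nat.add_sub_cancel]
      omega

theorem istar_eq {k m j : ℕ} (h : (2 * k) ^ m = (2 * k + 1) * j + 1) :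
    istar (2 * k) m = (k + 1) * j + 1 := by
  have h1 : (2 * k + 2) / 2 = k + 1 := by omega
  rw [istar, if_pos (even_two_mul k), h, h1]
  refine Nat.div_eq_of_eq_mul_right (by omega) ?_
  have : (k + 1) * ((2 * k + 1) * j + 1 + 1) = (2 * k + 1) * ((k + 1) * j + 1) + 1 := by ring
  omega

theorem deltaMax_quotient {q m j : ℕ} (hq : 1 ≤ q) (h : q ^ m = (q + 1) * j + 1)
    (hj : q ≤ j + 1) : (q ^ (m + 1) - q ^ 2 + q + 3) / (q + 1) = q * j + 3 - q := by
  have hqj : q ≤ q * j + 3 := by nlinarith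
  have hsq : q ^ 2 ≤ q ^ (m + 1) := by
    rw [pow_succ q m, h]
    nlinarith
  refine Nat.div_eq_of_eq_mul_right (by omega) ?_
  rw [pow_succ q m, h] at hsq ⊢
  zify [hqj, hsq]
  ring

theorem not_isPrimePow_six : ¬ IsPrimePow 6 := by
  rw [isPrimePow_nat_iff]
  rintro ⟨p, k, hp, -, h⟩
  have h2 := (Nat.prime_dvd_prime_iff_eq Nat.prime_two hp).1
    (Nat.prime_two.dvd_of_dvd_pow (show 2 ∣ p ^ k by omega))
  have h3 := (Nat.prime_dvd_prime_iff_eq Nat.prime_three hp).1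
    (Nat.prime_three.dvd_of_dvd_pow (show 3 ∣ p ^ k by omega))
  omega

theorem stmt7 (q m : ℕ) (hq : IsPrimePow q) (hqe : Even q) (hm : 2 ≤ m) (hme : Even m) :
    (2 < q → (q + 1) * istar q m ≤ q ^ (m + 1) - 2) ∧
    (q = 2 → q ^ (m + 1) - 2 < (q + 1) * istar q m) ∧
    (istar q m ≤ deltaMax q m - 2 ↔ (q = 4 ∧ 4 ≤ m) ∨ 8 ≤ q) := by
  have hq6 : q ≠ 6 := by rintro rfl; exact not_isPrimePow_six hq
  have hq1 : 1 < q := hq.one_lt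
  obtain ⟨k, rfl⟩ := even_iff_two_dvd.1 hqe
  obtain ⟨n, rfl⟩ : ∃ n, m = 2 * (n + 1) := by
    obtain ⟨l, rfl⟩ := even_iff_two_dvd.1 hme
    exact ⟨l - 1, by omega⟩
  obtain ⟨j, hj, hle, hj0, hj1⟩ := exists_pow_eq_succ_mul_add_one_s7 (2 * k) n (by omega)
  have hδ := deltaMax_quotient (by omega) hj hle
  rw [istar_eq hj, pow_succ, hj]
  refine ⟨fun h => ?_, fun h => ?_, ?_⟩
  · refine Nat.le_sub_of_add_le ?_
    nlinarith [Nat.mul_le_mul (show 2 ≤ k by omega) (show k + 1 ≤ j by omega)]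
  · obtain rfl : k = 1 := by omega
    omega
  · have hδ' : deltaMax (2 * k) (2 * (n + 1)) =
        if n = 0 ∧ 3 ≤ k then 2 * k * j + 3 - 2 * k + 1 else 2 * k * j + 3 - 2 * k := by
      rw [deltaMax, ← hδ]
      rcases Nat.eq_zero_or_pos n with rfl | hn
      · simp [show 5 ≤ 2 * k ↔ 3 ≤ k by omega]
      · simp [hn.ne']
    rw [hδ']
    obtain rfl | rfl | h4 : k = 1 ∨ k = 2 ∨ 4 ≤ k := by omega
    · simp
    · rcases Nat.eq_zero_or_pos n with rfl | hn
      · have := hj0 rfl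
        simp; omega
      · have := hj1 hn
        simp; omega
    · refine iff_of_true ?_ (Or.inr (by omega))
      have : (k + 1) * j + 2 * k ≤ 2 * k * j := by
        obtain ⟨s, rfl⟩ := Nat.exists_eq_add_of_le h4
        nlinarith
      split_ifs <;> omega
end

section
/- Let q be a prime power, m ≥ 2 an even integer, and r = q+1. For every integer δ with 2 ≤ δ ≤ δ^max, the cardinality of the union ∪_{i=0}^{δ−2} C_{1+r·i} of q²-cyclotomic cosets modulo q^{2m}−1 equals 𝒩(q,m,δ). -/
/-- `N₁ = ⌊(δ−(q+1))/q²⌋ + 1`, floor division in `ℤ`. -/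
def N1 (q δ : ℕ) : ℤ :=
  ((δ : ℤ) - ((q : ℤ) + 1)).fdiv ((q : ℤ) ^ 2) + 1

/-- `N₂ = ⌊(q+1)(δ−3)/(q^m−1) − ⌈(q+1)/2⌉⌋` when `q ≥ 5` and
`i*+2+(q^m−1)/(q+1) ≤ δ ≤ δ^max`, and `0` otherwise. -/
def N2 (q m δ : ℕ) : ℤ :=
  if 5 ≤ q ∧ istar q m + 2 + (q ^ m - 1) / (q + 1) ≤ δ ∧ δ ≤ deltaMax q m then
    (((q : ℤ) + 1) * ((δ : ℤ) - 3)).fdiv ((q : ℤ) ^ m - 1) - ((q + 2) / 2 : ℕ)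
  else 0

/-- `ι = 1` if `q` is even and `q ≥ 4`, else `0`. -/
def iota (q : ℕ) : ℤ := if Even q ∧ 4 ≤ q then 1 else 0

/-- The cardinality function `𝒩(q,m,δ)`. -/
def Ncal (q m δ : ℕ) : ℤ :=
  if δ < istar q m + 2 then ((δ : ℤ) - N1 q δ - 1) * m
  else if δ < istar q m + 2 + (q ^ m - 1) / (q + 1) then
    ((δ : ℤ) - N1 q δ - 1) * m - (m / 2 : ℕ) * iota q
  else ((δ : ℤ) - N1 q δ - 1 - N2 q m δ) * m - (m / 2 : ℕ) * iota q

lemma coset_subset_of_mem {q M s t : ℕ} (h : (t : ZMod M) ∈ coset q M s) :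
    coset q M t ⊆ coset q M s := by
  obtain ⟨l, hl⟩ := h
  rintro x ⟨k, rfl⟩
  exact ⟨l + k, by rw [hl]; ring⟩

lemma mem_coset_self (q M s : ℕ) : (s : ZMod M) ∈ coset q M s := ⟨0, by simp⟩

/-- Exponents of elements of a coset may be reduced below `m`. -/
lemma exists_lt_of_mem_coset {q M m s : ℕ} (hm : 0 < m) (hu : (q : ZMod M) ^ (2 * m) = 1)
    {x : ZMod M} (hx : x ∈ coset q M s) : ∃ l < m, x = (s : ZMod M) * (q : ZMod M) ^ (2 * l) := by
  obtain ⟨l, rfl⟩ := hx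
  refine ⟨l % m, Nat.mod_lt _ hm, ?_⟩
  conv_lhs => rw [← Nat.mod_add_div l m, mul_add, pow_add, ← mul_assoc 2, pow_mul _ (2 * m), hu]
  simp

/-- Two intersecting cosets: a representative of one lies in the other. -/
lemma mem_coset_of_not_disjoint {q M m s t : ℕ} (hm : 0 < m)
    (hu : (q : ZMod M) ^ (2 * m) = 1) (h : ¬ Disjoint (coset q M s) (coset q M t)) :
    (t : ZMod M) ∈ coset q M s := by
  obtain ⟨x, hs, ht⟩ := Set.not_disjoint_iff.1 h
  obtain ⟨k, hk⟩ := hs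
  obtain ⟨l, hl, rfl⟩ := exists_lt_of_mem_coset hm hu ht
  refine ⟨k + (m - l), ?_⟩
  rw [mul_add, pow_add, ← mul_assoc, ← hk, mul_assoc, ← pow_add, ← mul_add,
    Nat.add_sub_cancel' hl.le, hu, mul_one]

/-- The size of a coset is the least period of its representative. -/
lemma ncard_coset {q M m s p : ℕ} (hm : 0 < m) (hu : (q : ZMod M) ^ (2 * m) = 1) (hp : 0 < p)
    (hper : (s : ZMod M) = (s : ZMod M) * (q : ZMod M) ^ (2 * p))
    (hmin : ∀ l, 0 < l → l < p → (s : ZMod M) ≠ (s : ZMod M) * (q : ZMod M) ^ (2 * l)) :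
    (coset q M s).ncard = p := by
  have hunit : IsUnit (q : ZMod M) := IsUnit.of_pow_eq_one hu (by omega)
  have hmul : ∀ k, (s : ZMod M) * (q : ZMod M) ^ (2 * (p * k)) = s := by
    intro k
    induction k with
    | zero => simp
    | succ k ih =>
      rw [mul_add, mul_add, pow_add, ← mul_assoc, ih, mul_one]
      exact hper.symm
  have himg : coset q M s =
      (fun l : ℕ => (s : ZMod M) * (q : ZMod M) ^ (2 * l)) '' (Finset.range p : Set ℕ) := by
    ext x
    simp only [coset, Set.mem_ofPred_eq, Set.mem_image, Finset.coe_range, Set.mem_Iio]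
    constructor
    · rintro ⟨l, rfl⟩
      refine ⟨l % p, Nat.mod_lt _ hp, ?_⟩
      conv_rhs => rw [← Nat.div_add_mod l p, mul_add, pow_add, ← mul_assoc, hmul]
    · rintro ⟨l, -, rfl⟩
      exact ⟨l, rfl⟩
  have hlt : ∀ i j, i < j → j < p →
      (s : ZMod M) * (q : ZMod M) ^ (2 * i) ≠ (s : ZMod M) * (q : ZMod M) ^ (2 * j) := by
    intro i j hij hj h
    refine hmin (j - i) (by omega) (by omega) ((hunit.pow (2 * i)).mul_right_cancel ?_)
    rw [h, mul_assoc, ← pow_add]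
    congr 2
    omega
  rw [himg, Set.InjOn.ncard_image, Set.ncard_coe_finset, Finset.card_range]
  intro i hi j hj hij
  simp only [Finset.coe_range, Set.mem_Iio] at hi hj
  rcases lt_trichotomy i j with h | h | h
  · exact absurd hij (hlt i j h hj)
  · exact h
  · exact absurd hij.symm (hlt j i h hi)

lemma pow_mul_self_sub_one_cast {q h : ℕ} (hq : 2 ≤ q) :
    (q : ZMod (q ^ (2 * (2 * h)) - 1)) ^ (2 * (2 * h)) = 1 := by
  have h1 : 1 ≤ q ^ (2 * (2 * h)) := Nat.one_le_pow _ _ (by omega)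
  have := ZMod.natCast_self (q ^ (2 * (2 * h)) - 1)
  rw [Nat.cast_sub h1] at this
  push_cast at this
  exact sub_eq_zero.1 this

lemma dvd_of_cast_eq_mul_pow {q h s t l : ℕ} (hq : 2 ≤ q)
    (hs : s < q * q ^ (2 * h)) (ht : t < q * q ^ (2 * h)) (hl : 0 < l) (hlh : l < h)
    (heq : (t : ZMod (q ^ (2 * (2 * h)) - 1)) = s * (q : ZMod (q ^ (2 * (2 * h)) - 1)) ^ (2 * l)) :
    q ^ 2 ∣ t := by
  have hM : q * q ^ (2 * h) * q ^ (2 * l) < q ^ (2 * (2 * h)) - 1 := by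
    have e : q * q ^ (2 * h) * q ^ (2 * l) = q ^ (1 + 2 * h + 2 * l) := by ring
    have h2 : q ^ (1 + 2 * h + 2 * l + 1) ≤ q ^ (2 * (2 * h)) :=
      Nat.pow_le_pow_right (by omega) (by omega)
    have h3 : 2 ≤ q ^ (1 + 2 * h + 2 * l) :=
      hq.trans (Nat.le_self_pow (by omega) q)
    rw [e]
    rw [pow_succ] at h2
    have : q ^ (1 + 2 * h + 2 * l) * 2 ≤ q ^ (1 + 2 * h + 2 * l) * q :=
      Nat.mul_le_mul_left _ hq
    omega
  have hpos : 0 < q ^ (2 * l) := Nat.pow_pos (by omega)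
  have hsl : s * q ^ (2 * l) < q ^ (2 * (2 * h)) - 1 :=
    lt_of_le_of_lt (Nat.mul_le_mul_right _ hs.le) hM
  have htl : t < q ^ (2 * (2 * h)) - 1 :=
    lt_of_lt_of_le (lt_of_lt_of_le ht (Nat.le_mul_of_pos_right _ hpos)) hM.le
  have e : ((t : ℕ) : ZMod (q ^ (2 * (2 * h)) - 1)) = ((s * q ^ (2 * l) : ℕ) : ZMod _) := by
    rw [heq]; push_cast; rfl
  rw [ZMod.natCast_eq_natCast_iff', Nat.mod_eq_of_lt hsl, Nat.mod_eq_of_lt htl] at e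
  rw [e]
  exact Dvd.dvd.mul_left (pow_dvd_pow q (by omega)) s

/-- Half-turn of the base-`q²` digits. -/
lemma cast_swap {q h : ℕ} (hq : 2 ≤ q) (a b : ℕ) :
    ((b * q ^ (2 * h) + a : ℕ) : ZMod (q ^ (2 * (2 * h)) - 1)) =
      ((a * q ^ (2 * h) + b : ℕ) : ZMod _) * (q : ZMod (q ^ (2 * (2 * h)) - 1)) ^ (2 * h) := by
  have := pow_mul_self_sub_one_cast (h := h) hq
  have e : (q : ZMod (q ^ (2 * (2 * h)) - 1)) ^ (2 * (2 * h)) =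
    (q : ZMod (q ^ (2 * (2 * h)) - 1)) ^ (2 * h) * (q : ZMod (q ^ (2 * (2 * h)) - 1)) ^ (2 * h) := by ring
  push_cast
  rw [add_mul, mul_assoc, ← e, this]
  ring

lemma exists_pow_eq {q : ℕ} (hq : 2 ≤ q) {h : ℕ} (hh : 1 ≤ h) :
    ∃ B, 1 ≤ B ∧ q ^ (2 * h) = (q + 1) * B + 1 := by
  have h1 : q + 1 ∣ q ^ (2 * h) - 1 := by
    have h2 := Nat.sub_dvd_pow_sub_pow (q ^ 2) 1 h
    rw [one_pow, ← pow_mul] at h2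
    refine dvd_trans ⟨q - 1, ?_⟩ h2
    have := Nat.sq_sub_sq q 1
    simpa using this
  obtain ⟨B, hB⟩ := h1
  have h3 : q ^ 0 < q ^ (2 * h) := Nat.pow_lt_pow_right (by omega) (by omega)
  rw [pow_zero] at h3
  refine ⟨B, ?_, by omega⟩
  rcases Nat.eq_zero_or_pos B with rfl | h0
  · omega
  · exact h0

lemma eq_swap_of_cast_eq {q h s t l : ℕ} (hq : 2 ≤ q) (hh : 1 ≤ h)
    (hs : s < q * q ^ (2 * h)) (ht : t < q * q ^ (2 * h))
    (hsd : ¬ q ^ 2 ∣ s) (htd : ¬ q ^ 2 ∣ t) (hs1 : s % (q + 1) = 1)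
    (hl : 0 < l) (hlm : l < 2 * h)
    (heq : (t : ZMod (q ^ (2 * (2 * h)) - 1)) = s * (q : ZMod (q ^ (2 * (2 * h)) - 1)) ^ (2 * l)) :
    l = h ∧ ∃ a b, a + b = q + 2 ∧ a < q ∧ b < q ∧
      s = a * q ^ (2 * h) + b ∧ t = b * q ^ (2 * h) + a := by
  have hu := pow_mul_self_sub_one_cast (h := h) hq
  rcases lt_trichotomy l h with hlh | rfl | hlh
  · exact absurd (dvd_of_cast_eq_mul_pow hq hs ht hl hlh heq) htd
  · refine ⟨rfl, s / q ^ (2 * l), s % q ^ (2 * l), ?_⟩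
    have hpos : 0 < q ^ (2 * l) := Nat.pow_pos (by omega)
    have hsplit : s = s / q ^ (2 * l) * q ^ (2 * l) + s % q ^ (2 * l) := by
      rw [mul_comm]; exact (Nat.div_add_mod _ _).symm
    have hd : q ^ 2 ∣ q ^ (2 * l) := pow_dvd_pow q (by omega)
    have ha : s / q ^ (2 * l) < q := Nat.div_lt_of_lt_mul (by rwa [mul_comm])
    have hb : s % q ^ (2 * l) < q ^ (2 * l) := Nat.mod_lt _ hpos
    obtain ⟨B, -, hB⟩ := exists_pow_eq hq hh
    generalize s / q ^ (2 * l) = a at *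
    generalize s % q ^ (2 * l) = b at *
    subst hsplit
    rw [← cast_swap hq] at heq
    have hMe : q ^ (2 * (2 * l)) = q ^ (2 * l) * q ^ (2 * l) := by ring
    have hqP : q < q ^ (2 * l) := by
      calc q = q ^ 1 := (pow_one q).symm
        _ < _ := Nat.pow_lt_pow_right (by omega) (by omega)
    rw [ZMod.natCast_eq_natCast_iff'] at heq
    generalize q ^ (2 * l) = P at *
    have h1 : b * P + a < q ^ (2 * (2 * l)) - 1 := by
      have : (b + 1) * P ≤ P * P := Nat.mul_le_mul_right _ hb
      rw [add_mul] at this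
      omega
    have h2 : t < q ^ (2 * (2 * l)) - 1 := by
      have : (q + 1) * P ≤ P * P := Nat.mul_le_mul_right _ hqP
      rw [add_mul] at this
      omega
    rw [Nat.mod_eq_of_lt h1, Nat.mod_eq_of_lt h2] at heq
    subst heq
    have hbq : b < q := by
      by_contra hc
      have : q * P ≤ b * P := Nat.mul_le_mul_right _ (by omega)
      omega
    have ha0 : a ≠ 0 := by
      rintro rfl
      exact htd (by simpa using Dvd.dvd.mul_left hd b)
    have hb0 : b ≠ 0 := by
      rintro rfl
      exact hsd (by simpa using Dvd.dvd.mul_left hd a)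
    have hab : (a + b) % (q + 1) = 1 := by
      refine Eq.trans ?_ hs1
      have : a * ((q + 1) * B + 1) + b = (a + b) + (q + 1) * (a * B) := by ring
      rw [hB, this, Nat.add_mul_mod_self_left]
    refine ⟨?_, ha, hbq, rfl, rfl⟩
    have h3 := Nat.div_add_mod (a + b) (q + 1)
    rw [hab] at h3
    have h4 : (a + b) / (q + 1) < 2 := Nat.div_lt_of_lt_mul (by omega)
    generalize (a + b) / (q + 1) = k at *
    interval_cases k <;> omega
  · refine absurd (dvd_of_cast_eq_mul_pow (l := 2 * h - l) hq ht hs (by omega) (by omega) ?_) hsd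
    rw [heq, mul_assoc, ← pow_add, ← mul_add, Nat.add_sub_cancel' hlm.le, hu, mul_one]

lemma sq_dvd_iff {q n : ℕ} (hq : 2 ≤ q) : q ^ 2 ∣ 1 + (q + 1) * n ↔ n % q ^ 2 = q - 1 := by
  obtain ⟨p, rfl⟩ : ∃ p, q = p + 1 := ⟨q - 1, by omega⟩
  have hlt : p < (p + 1) ^ 2 := by nlinarith
  constructor
  · intro h
    have h1 : (p + 1) ^ 2 ∣ (p : ℕ) * (1 + (p + 1 + 1) * n) := Dvd.dvd.mul_left h p
    have h2 : p * (1 + (p + 1 + 1) * n) + n = p + (p + 1) ^ 2 * n := by ring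
    obtain ⟨k, hk⟩ := h1
    rw [hk] at h2
    have := congrArg (· % (p + 1) ^ 2) h2
    simpa [Nat.mul_add_mod, Nat.add_mul_mod_self_left, Nat.mod_eq_of_lt hlt] using this
  · intro h
    have h1 := Nat.div_add_mod n ((p + 1) ^ 2)
    rw [h] at h1
    refine ⟨1 + (p + 1 + 1) * (n / (p + 1) ^ 2), ?_⟩
    conv_lhs => rw [← h1]
    simp only [Nat.add_sub_cancel]
    ring

/-- The union of the first `n` cosets `C_{1 + (q+1) i}` modulo `q^{4h} - 1`. -/
def cosetUnion (q h n : ℕ) : Set (ZMod (q ^ (2 * (2 * h)) - 1)) :=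
  ⋃ i ∈ Finset.range n, coset q (q ^ (2 * (2 * h)) - 1) (1 + (q + 1) * i)

lemma cosetUnion_succ (q h n : ℕ) :
    cosetUnion q h (n + 1) =
      cosetUnion q h n ∪ coset q (q ^ (2 * (2 * h)) - 1) (1 + (q + 1) * n) := by
  rw [cosetUnion, Finset.range_add_one, Finset.set_biUnion_insert, Set.union_comm]
  rfl

lemma subset_cosetUnion {q h n j : ℕ} (hj : j < n) :
    coset q (q ^ (2 * (2 * h)) - 1) (1 + (q + 1) * j) ⊆ cosetUnion q h n := by
  intro x hx
  exact Set.mem_biUnion (Finset.mem_coe.2 (Finset.mem_range.2 hj)) hx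

/-- The digit form of the exceptional representatives. -/
lemma one_add_mul_eq {q P B a b : ℕ} (hB : P = (q + 1) * B + 1) (hab : a + b = q + 2) :
    1 + (q + 1) * (a * B + 1) = a * P + b := by
  have : a * ((q + 1) * B + 1) + b = (q + 1) * (a * B) + (a + b) := by ring
  rw [hB, this, hab]
  ring

lemma lt_of_one_add_mul_lt {q P B a : ℕ} (hB : P = (q + 1) * B + 1)
    (hn : 1 + (q + 1) * (a * B + 1) < q * P) : a < q := by
  by_contra hc
  have h1 : q * B ≤ a * B := Nat.mul_le_mul_right _ (by omega)
  have h2 : (q + 1) * (q * B + 1) ≤ (q + 1) * (a * B + 1) := Nat.mul_le_mul_left _ (by omega)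
  have h3 : (q + 1) * (q * B + 1) = q * ((q + 1) * B + 1) + 1 := by ring
  rw [hB] at hn
  omega

lemma mod_ne_of_exceptional {q h B a : ℕ} (hq : 2 ≤ q) (hh : 1 ≤ h)
    (hB : q ^ (2 * h) = (q + 1) * B + 1) (ha : q + 2 ≤ 2 * a)
    (hn : 1 + (q + 1) * (a * B + 1) < q * q ^ (2 * h)) : (a * B + 1) % q ^ 2 ≠ q - 1 := by
  intro hA
  have haq := lt_of_one_add_mul_lt hB hn
  rw [← sq_dvd_iff hq, one_add_mul_eq hB (b := q + 2 - a) (by omega)] at hA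
  have hd : q ^ 2 ∣ a * q ^ (2 * h) := Dvd.dvd.mul_left (pow_dvd_pow q (by omega)) a
  have := Nat.le_of_dvd (by omega) ((Nat.dvd_add_right hd).1 hA)
  have hQ : q < q ^ 2 := by nlinarith
  omega

lemma coset_subset_of_mod_eq {q h n : ℕ} (hq : 2 ≤ q) (hA : n % q ^ 2 = q - 1) :
    coset q (q ^ (2 * (2 * h)) - 1) (1 + (q + 1) * n) ⊆ cosetUnion q h n := by
  have h1 := Nat.div_add_mod n (q ^ 2)
  rw [hA] at h1
  have hk : n / q ^ 2 < n := by
    refine Nat.div_lt_self ?_ (by nlinarith)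
    generalize q ^ 2 * (n / q ^ 2) = z at h1
    omega
  refine (coset_subset_of_mem ⟨1, ?_⟩).trans (subset_cosetUnion hk)
  have h2 : 1 + (q + 1) * n = (1 + (q + 1) * (n / q ^ 2)) * q ^ (2 * 1) := by
    generalize n / q ^ 2 = k at h1
    rw [← h1]
    obtain ⟨p, rfl⟩ : ∃ p, q = p + 1 := ⟨q - 1, by omega⟩
    simp only [Nat.add_sub_cancel]
    ring
  rw [h2]
  push_cast
  rfl

lemma coset_subset_of_dup {q h B a : ℕ} (hq : 2 ≤ q) (hB1 : 1 ≤ B)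
    (hB : q ^ (2 * h) = (q + 1) * B + 1) (ha : q + 2 < 2 * a) (haq : a < q) :
    coset q (q ^ (2 * (2 * h)) - 1) (1 + (q + 1) * (a * B + 1)) ⊆
      cosetUnion q h (a * B + 1) := by
  have hlt : (q + 2 - a) * B + 1 < a * B + 1 := by
    have : (q + 2 - a) * B < a * B := Nat.mul_lt_mul_of_pos_right (by omega) hB1
    omega
  refine (coset_subset_of_mem ⟨h, ?_⟩).trans (subset_cosetUnion hlt)
  rw [one_add_mul_eq hB (b := q + 2 - a) (by omega), one_add_mul_eq hB (b := a) (by omega)]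
  exact cast_swap hq _ _

lemma disjoint_cosetUnion {q h n B : ℕ} (hq : 2 ≤ q) (hh : 1 ≤ h)
    (hB : q ^ (2 * h) = (q + 1) * B + 1) (hn : 1 + (q + 1) * n < q * q ^ (2 * h))
    (hA : n % q ^ 2 ≠ q - 1) (hD : ¬ ∃ a, n = a * B + 1 ∧ q + 2 < 2 * a) :
    Disjoint (cosetUnion q h n) (coset q (q ^ (2 * (2 * h)) - 1) (1 + (q + 1) * n)) := by
  classical
  by_contra hdis
  have hu := pow_mul_self_sub_one_cast (h := h) hq
  have hex : ∃ j, j < n ∧ ((1 + (q + 1) * n : ℕ) : ZMod (q ^ (2 * (2 * h)) - 1)) ∈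
      coset q (q ^ (2 * (2 * h)) - 1) (1 + (q + 1) * j) := by
    rw [cosetUnion] at hdis
    simp only [Set.disjoint_iUnion_left, not_forall] at hdis
    obtain ⟨j, hj, hdj⟩ := hdis
    exact ⟨j, Finset.mem_range.1 hj, mem_coset_of_not_disjoint (m := 2 * h) (by omega) hu hdj⟩
  obtain ⟨hj, hmem⟩ := Nat.find_spec hex
  have hmin := fun k (hk : k < Nat.find hex) => Nat.find_min hex hk
  generalize Nat.find hex = j at hj hmem hmin
  have hjA : ¬ q ^ 2 ∣ 1 + (q + 1) * j := by
    rw [sq_dvd_iff hq]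
    intro hjA
    have hsub := coset_subset_of_mod_eq (h := h) hq hjA hmem
    simp only [cosetUnion, Set.mem_iUnion] at hsub
    obtain ⟨k, hk, hk'⟩ := hsub
    have hk := Finset.mem_range.1 hk
    exact hmin k hk ⟨hk.trans hj, hk'⟩
  have hlt : 1 + (q + 1) * j < 1 + (q + 1) * n := by
    have := Nat.mul_lt_mul_of_pos_left hj (Nat.succ_pos q)
    simp only [Nat.succ_eq_add_one] at this
    omega
  obtain ⟨l, hl, heq⟩ := exists_lt_of_mem_coset (m := 2 * h) (by omega) hu hmem
  rcases Nat.eq_zero_or_pos l with rfl | hl0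
  · rw [mul_zero, pow_zero, mul_one, ZMod.natCast_eq_natCast_iff'] at heq
    have hM : q * q ^ (2 * h) ≤ q ^ (2 * (2 * h)) - 1 := by
      have e : q ^ (2 * (2 * h)) = q ^ (2 * h) * q ^ (2 * h) := by ring
      have h1 : q < q ^ (2 * h) := by
        calc q = q ^ 1 := (pow_one q).symm
          _ < _ := Nat.pow_lt_pow_right (by omega) (by omega)
      have h2 : (q + 1) * q ^ (2 * h) ≤ q ^ (2 * h) * q ^ (2 * h) := Nat.mul_le_mul_right _ h1
      rw [add_mul] at h2
      omega
    rw [Nat.mod_eq_of_lt (by omega), Nat.mod_eq_of_lt (by omega)] at heq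
    omega
  · have hmod : (1 + (q + 1) * j) % (q + 1) = 1 := by
      rw [Nat.add_mul_mod_self_left, Nat.mod_eq_of_lt (by omega)]
    obtain ⟨-, a, b, hab, haq, hbq, hsj, hsn⟩ := eq_swap_of_cast_eq hq hh (by omega) hn hjA
      ((sq_dvd_iff hq).not.2 hA) hmod hl0 hl heq
    refine hD ⟨b, ?_, ?_⟩
    · rw [← one_add_mul_eq hB (by omega)] at hsn
      have := Nat.eq_of_mul_eq_mul_left (Nat.succ_pos q) (Nat.add_left_cancel hsn)
      exact this
    · by_contra hc
      have hP : b * q ^ (2 * h) ≤ a * q ^ (2 * h) := Nat.mul_le_mul_right _ (by omega)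
      rcases Nat.lt_or_ge b a with hba | hba
      · have : (b + 1) * q ^ (2 * h) ≤ a * q ^ (2 * h) := Nat.mul_le_mul_right _ hba
        have hqP : q < q ^ (2 * h) := by
          calc q = q ^ 1 := (pow_one q).symm
            _ < _ := Nat.pow_lt_pow_right (by omega) (by omega)
        rw [add_mul] at this
        omega
      · obtain rfl : a = b := by omega
        omega

lemma ncard_coset_short {q h B a : ℕ} (hq : 2 ≤ q) (hh : 1 ≤ h)
    (hB : q ^ (2 * h) = (q + 1) * B + 1)
    (hn : 1 + (q + 1) * (a * B + 1) < q * q ^ (2 * h)) (ha : 2 * a = q + 2) :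
    (coset q (q ^ (2 * (2 * h)) - 1) (1 + (q + 1) * (a * B + 1))).ncard = h := by
  have hA := (sq_dvd_iff hq).not.2 (mod_ne_of_exceptional hq hh hB ha.ge hn)
  refine ncard_coset (m := 2 * h) (by omega) (pow_mul_self_sub_one_cast hq) hh ?_ ?_
  · rw [one_add_mul_eq hB (b := a) (by omega)]
    exact cast_swap hq _ _
  · intro l hl hlh heq
    have hmod : (1 + (q + 1) * (a * B + 1)) % (q + 1) = 1 := by
      rw [Nat.add_mul_mod_self_left, Nat.mod_eq_of_lt (by omega)]
    have := (eq_swap_of_cast_eq hq hh hn hn hA hA hmod hl (by omega) heq).1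
    omega

lemma ncard_coset_full {q h n B : ℕ} (hq : 2 ≤ q) (hh : 1 ≤ h)
    (hB : q ^ (2 * h) = (q + 1) * B + 1) (hn : 1 + (q + 1) * n < q * q ^ (2 * h))
    (hA : n % q ^ 2 ≠ q - 1) (hS : ¬ ∃ a, n = a * B + 1 ∧ 2 * a = q + 2) :
    (coset q (q ^ (2 * (2 * h)) - 1) (1 + (q + 1) * n)).ncard = 2 * h := by
  have hu := pow_mul_self_sub_one_cast (h := h) hq
  have hA := (sq_dvd_iff hq).not.2 hA
  refine ncard_coset (m := 2 * h) (by omega) hu (by omega) (by rw [hu, mul_one]) ?_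
  intro l hl hlh heq
  have hmod : (1 + (q + 1) * n) % (q + 1) = 1 := by
    rw [Nat.add_mul_mod_self_left, Nat.mod_eq_of_lt (by omega)]
  obtain ⟨-, a, b, hab, haq, hbq, h1, h2⟩ :=
    eq_swap_of_cast_eq hq hh hn hn hA hA hmod hl (by omega) heq
  have hqP : q < q ^ (2 * h) := by
    calc q = q ^ 1 := (pow_one q).symm
      _ < _ := Nat.pow_lt_pow_right (by omega) (by omega)
  obtain rfl : a = b := by
    rcases lt_trichotomy a b with hlt | heq | hlt
    · have : (a + 1) * q ^ (2 * h) ≤ b * q ^ (2 * h) := Nat.mul_le_mul_right _ hlt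
      rw [add_mul] at this
      omega
    · exact heq
    · have : (b + 1) * q ^ (2 * h) ≤ a * q ^ (2 * h) := Nat.mul_le_mul_right _ hlt
      rw [add_mul] at this
      omega
  refine hS ⟨a, ?_, by omega⟩
  rw [← one_add_mul_eq hB hab] at h1
  exact Nat.eq_of_mul_eq_mul_left (Nat.succ_pos q) (Nat.add_left_cancel h1)

open Classical in
lemma ncard_cosetUnion_succ {q h n B : ℕ} (hq : 2 ≤ q) (hh : 1 ≤ h) (hB1 : 1 ≤ B)
    (hB : q ^ (2 * h) = (q + 1) * B + 1) (hn : 1 + (q + 1) * n < q * q ^ (2 * h)) :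
    (cosetUnion q h (n + 1)).ncard = (cosetUnion q h n).ncard +
      if n % q ^ 2 = q - 1 ∨ ∃ a, n = a * B + 1 ∧ q + 2 < 2 * a then 0
      else if ∃ a, n = a * B + 1 ∧ 2 * a = q + 2 then h else 2 * h := by
  have hM : q ^ (2 * (2 * h)) - 1 ≠ 0 := by
    have : q ^ 0 < q ^ (2 * (2 * h)) := Nat.pow_lt_pow_right (by omega) (by omega)
    rw [pow_zero] at this
    omega
  have : NeZero (q ^ (2 * (2 * h)) - 1) := ⟨hM⟩
  rw [cosetUnion_succ]
  split_ifs with h1 h2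
  · rw [add_zero, Set.union_eq_self_of_subset_right]
    rcases h1 with hA | ⟨a, rfl, ha⟩
    · exact coset_subset_of_mod_eq hq hA
    · exact coset_subset_of_dup hq hB1 hB ha (lt_of_one_add_mul_lt hB hn)
  · rw [not_or] at h1
    rw [Set.ncard_union_eq (disjoint_cosetUnion hq hh hB hn h1.1 h1.2)]
    obtain ⟨a, rfl, ha⟩ := h2
    rw [ncard_coset_short hq hh hB hn ha]
  · rw [not_or] at h1
    rw [Set.ncard_union_eq (disjoint_cosetUnion hq hh hB hn h1.1 h1.2),
      ncard_coset_full hq hh hB hn h1.1 h2]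

/-- How the number of `i < n` with `i ≡ q - 1 mod q²` grows. -/
lemma div_sq_succ {q : ℕ} (hq : 2 ≤ q) (n : ℕ) :
    (n + 1 + q ^ 2 - q) / q ^ 2 = (n + q ^ 2 - q) / q ^ 2 + if n % q ^ 2 = q - 1 then 1 else 0 := by
  have hQ : q < q ^ 2 := by nlinarith
  have e : n + 1 + q ^ 2 - q = (n + q ^ 2 - q) + 1 := by omega
  rw [e, Nat.succ_div]
  congr 1
  refine if_congr ?_ rfl rfl
  rw [← e, Nat.dvd_iff_mod_eq_zero]
  have hn := Nat.div_add_mod n (q ^ 2)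
  have hlt := Nat.mod_lt n (show 0 < q ^ 2 by omega)
  generalize n / q ^ 2 = k at hn
  generalize n % q ^ 2 = s at *
  subst hn
  have e2 : q ^ 2 * k + s + 1 + q ^ 2 - q = (s + 1 + q ^ 2 - q) + q ^ 2 * k := by omega
  rw [e2, Nat.add_mul_mod_self_left]
  constructor
  · intro h
    by_contra hc
    rcases Nat.lt_or_ge (s + 1) q with h1 | h1
    · rw [Nat.mod_eq_of_lt (by omega)] at h
      omega
    · have e3 : s + 1 + q ^ 2 - q = (s + 1 - q) + q ^ 2 := by omega
      rw [e3, Nat.add_mod_right, Nat.mod_eq_of_lt (by omega)] at h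
      omega
  · rintro rfl
    have e3 : q - 1 + 1 + q ^ 2 - q = q ^ 2 := by omega
    rw [e3, Nat.mod_self]

open Classical in
/-- How the number of repeated exceptional representatives grows. -/
lemma div_sub_succ {B : ℕ} (hB1 : 1 ≤ B) (c n : ℕ) (hc : 1 ≤ c) :
    (n + 1 - 2) / B - c = ((n - 2) / B - c) + if ∃ a, n = a * B + 1 ∧ c < a then 1 else 0 := by
  rcases Nat.lt_or_ge n 2 with h | h
  · rw [if_neg]
    · have h1 : n + 1 - 2 = 0 := by omega
      have h2 : n - 2 = 0 := by omega
      rw [h1, h2, add_zero]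
    · rintro ⟨a, rfl, ha⟩
      have := Nat.mul_le_mul (show 1 ≤ a by omega) hB1
      omega
  · obtain ⟨k, rfl⟩ : ∃ k, n = k + 2 := ⟨n - 2, by omega⟩
    have e : k + 2 + 1 - 2 = k + 1 := by omega
    rw [e, Nat.add_sub_cancel, Nat.succ_div]
    by_cases hd : B ∣ k + 1
    · have hs := Nat.succ_div_of_dvd hd
      rw [if_pos hd]
      obtain ⟨a, ha⟩ := hd
      have hka : (k + 1) / B = a := by rw [ha, Nat.mul_div_cancel_left _ hB1]
      by_cases hca : c < a
      · rw [if_pos ⟨a, by rw [mul_comm, ← ha], hca⟩]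
        omega
      · rw [if_neg]
        · omega
        · rintro ⟨a', h1, h2⟩
          have : B * a = B * a' := by rw [← ha, mul_comm B a']; omega
          have := Nat.eq_of_mul_eq_mul_left hB1 this
          omega
    · rw [if_neg hd, if_neg]
      · rfl
      · rintro ⟨a, h1, -⟩
        exact hd ⟨a, by rw [mul_comm]; omega⟩

lemma ncard_cosetUnion {q h B : ℕ} (hq : 2 ≤ q) (hh : 1 ≤ h) (hB1 : 1 ≤ B)
    (hB : q ^ (2 * h) = (q + 1) * B + 1) (n : ℕ)
    (hn : n = 0 ∨ 1 + (q + 1) * (n - 1) < q * q ^ (2 * h)) :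
    ((cosetUnion q h n).ncard : ℤ) =
      ((n : ℤ) - ((n + q ^ 2 - q) / q ^ 2 : ℕ) - (((n - 2) / B - (q + 2) / 2 : ℕ) : ℤ)) * (2 * h)
        - h * (if (q + 2) / 2 * B + 2 ≤ n ∧ Even q then 1 else 0) := by
  classical
  have hQ : q < q ^ 2 := by nlinarith
  induction n with
  | zero =>
    have : (0 + q ^ 2 - q) / q ^ 2 = 0 := Nat.div_eq_of_lt (by omega)
    rw [this]
    simp [cosetUnion]
  | succ n ih =>
    have hn' : 1 + (q + 1) * n < q * q ^ (2 * h) := by simpa using hn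
    have hprev : n = 0 ∨ 1 + (q + 1) * (n - 1) < q * q ^ (2 * h) := by
      right
      have : (q + 1) * (n - 1) ≤ (q + 1) * n := Nat.mul_le_mul_left _ (by omega)
      omega
    rw [ncard_cosetUnion_succ hq hh hB1 hB hn', div_sq_succ hq, div_sub_succ hB1 _ _ (by omega),
      Nat.cast_add, ih hprev]
    have hexc : ∀ a, n = a * B + 1 → q + 2 ≤ 2 * a → n % q ^ 2 ≠ q - 1 := by
      rintro a rfl ha
      exact mod_ne_of_exceptional hq hh hB ha hn'
    have hD : (∃ a, n = a * B + 1 ∧ (q + 2) / 2 < a) ↔ ∃ a, n = a * B + 1 ∧ q + 2 < 2 * a :=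
      exists_congr fun a => and_congr_right fun _ => by omega
    have hS : (∃ a, n = a * B + 1 ∧ 2 * a = q + 2) ↔ n = (q + 2) / 2 * B + 1 ∧ Even q := by
      constructor
      · rintro ⟨a, rfl, ha⟩
        obtain rfl : a = (q + 2) / 2 := by omega
        exact ⟨rfl, ⟨(q + 2) / 2 - 1, by omega⟩⟩
      · rintro ⟨h1, ⟨k, hk⟩⟩
        exact ⟨_, h1, by omega⟩
    have hDS : (∃ a, n = a * B + 1 ∧ q + 2 < 2 * a) → n ≠ (q + 2) / 2 * B + 1 := by
      rintro ⟨a, h1, h2⟩ h3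
      have : (q + 2) / 2 * B < a * B := Nat.mul_lt_mul_of_pos_right (by omega) hB1
      omega
    have hSA : n = (q + 2) / 2 * B + 1 ∧ Even q → n % q ^ 2 ≠ q - 1 := by
      rintro ⟨h1, ⟨k, hk⟩⟩
      exact hexc _ h1 (by omega)
    have hDA : (∃ a, n = a * B + 1 ∧ q + 2 < 2 * a) → n % q ^ 2 ≠ q - 1 := by
      rintro ⟨a, h1, h2⟩
      exact hexc a h1 h2.le
    have hJ : (if (q + 2) / 2 * B + 2 ≤ n + 1 ∧ Even q then (1 : ℤ) else 0) =
        (if (q + 2) / 2 * B + 2 ≤ n ∧ Even q then 1 else 0) +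
          if n = (q + 2) / 2 * B + 1 ∧ Even q then 1 else 0 := by
      by_cases he : Even q
      · simp only [he, and_true]
        split_ifs <;> omega
      · simp [he]
    rw [hD, hS, hJ]
    generalize (n + q ^ 2 - q) / q ^ 2 = K₁
    generalize (n - 2) / B - (q + 2) / 2 = K₂
    generalize (if (q + 2) / 2 * B + 2 ≤ n ∧ Even q then (1 : ℤ) else 0) = J
    by_cases c1 : n % q ^ 2 = q - 1
    · have c2 := fun h => hDA h c1
      have c3 := fun h => hSA h c1
      rw [if_pos (Or.inl c1), if_pos c1, if_neg c2, if_neg c3]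
      push_cast
      ring
    · by_cases c2 : ∃ a, n = a * B + 1 ∧ q + 2 < 2 * a
      · rw [if_pos (Or.inr c2), if_neg c1, if_pos c2, if_neg (fun h => hDS c2 h.1)]
        push_cast
        ring
      · rw [if_neg (not_or.2 ⟨c1, c2⟩), if_neg c1, if_neg c2]
        split_ifs <;> push_cast <;> ring

lemma istar_eq_s8 {q h B : ℕ} (hB : q ^ (2 * h) = (q + 1) * B + 1) :
    istar q (2 * h) = (q + 2) / 2 * B + 1 := by
  unfold istar
  rw [hB]
  have e : (q + 2) / 2 * ((q + 1) * B + 1 + 1) =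
      (q + 1) * ((q + 2) / 2 * B) + 2 * ((q + 2) / 2) := by ring
  have e2 : (q + 2) / 2 * ((q + 1) * B + 1 + 1) - (if Even q then 1 else 0) =
      (q + 1) * ((q + 2) / 2 * B + 1) := by
    rw [e, mul_add]
    split_ifs with hev
    · obtain ⟨k, hk⟩ := hev
      omega
    · rw [Nat.not_even_iff_odd] at hev
      obtain ⟨k, hk⟩ := hev
      omega
  rw [e2, Nat.mul_div_cancel_left _ (Nat.succ_pos q)]

lemma one_add_mul_lt_of_le_deltaMax {q h δ : ℕ} (hq : 2 ≤ q) (hh : 1 ≤ h) (hδ : 2 ≤ δ)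
    (hδmax : δ ≤ deltaMax q (2 * h)) : 1 + (q + 1) * (δ - 2) < q * q ^ (2 * h) := by
  obtain ⟨d, rfl⟩ : ∃ d, δ = d + 2 := ⟨δ - 2, by omega⟩
  rw [Nat.add_sub_cancel]
  unfold deltaMax at hδmax
  have hQ : 2 * q ≤ q ^ 2 := by nlinarith
  split_ifs at hδmax with hc
  · have h1 : d + 1 ≤ (q ^ 3 - q ^ 2 + q + 3) / (q + 1) := by omega
    rw [Nat.le_div_iff_mul_le (show 0 < q + 1 by omega)] at h1
    have h2 : q * q ^ (2 * h) = q ^ 3 := by rw [hc.1]; ring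
    have h3 : (d + 1) * (q + 1) = (q + 1) * d + (q + 1) := by ring
    have h4 : q ^ 2 ≤ q ^ 3 := Nat.pow_le_pow_right (by omega) (by omega)
    omega
  · rw [Nat.le_div_iff_mul_le (show 0 < q + 1 by omega)] at hδmax
    have h2 : q * q ^ (2 * h) = q ^ (2 * h + 1) := by ring
    have h3 : (d + 2) * (q + 1) = (q + 1) * d + 2 * (q + 1) := by ring
    have h4 : q ^ 2 ≤ q ^ (2 * h + 1) := Nat.pow_le_pow_right (by omega) (by omega)
    omega

lemma N1_eq {q n : ℕ} (hq : 2 ≤ q) : N1 q (n + 1) = ((n + q ^ 2 - q) / q ^ 2 : ℕ) := by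
  have hQ : q ≤ q ^ 2 := by nlinarith
  have hQ0 : (0 : ℤ) < (q : ℤ) ^ 2 := by positivity
  unfold N1
  have e : ((n + q ^ 2 - q : ℕ) : ℤ) = ((n + 1 : ℕ) : ℤ) - ((q : ℤ) + 1) + 1 * (q : ℤ) ^ 2 := by
    push_cast [Nat.cast_sub (show q ≤ n + q ^ 2 by omega)]
    ring
  rw [Int.fdiv_eq_ediv_of_nonneg _ hQ0.le, Int.natCast_ediv, e, Nat.cast_pow,
    Int.add_mul_ediv_right _ _ hQ0.ne']

lemma N2_eq {q h B n : ℕ} (hq : 2 ≤ q) (hB1 : 1 ≤ B)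
    (hB : q ^ (2 * h) = (q + 1) * B + 1) (hge : ((q + 2) / 2 + 1) * B + 2 ≤ n)
    (hlt : (n - 2) / B < q) (hmax : n + 1 ≤ deltaMax q (2 * h)) :
    N2 q (2 * h) (n + 1) = ((n - 2) / B - (q + 2) / 2 : ℕ) := by
  have hle : (q + 2) / 2 + 1 ≤ (n - 2) / B := by
    rw [Nat.le_div_iff_mul_le hB1]
    omega
  have hdiv : (q ^ (2 * h) - 1) / (q + 1) = B := by
    rw [hB, Nat.add_sub_cancel, Nat.mul_div_cancel_left _ (Nat.succ_pos q)]
  unfold N2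
  rw [istar_eq_s8 hB, hdiv]
  split_ifs with hc
  · have e1 : (q : ℤ) ^ (2 * h) - 1 = ((q : ℤ) + 1) * B := by
      have := congrArg (Nat.cast : ℕ → ℤ) hB
      push_cast at this
      omega
    have e2 : ((n + 1 : ℕ) : ℤ) - 3 = ((n - 2 : ℕ) : ℤ) := by
      omega
    rw [e1, e2, Int.fdiv_eq_ediv_of_nonneg _ (by positivity),
      Int.mul_ediv_mul_of_pos _ _ (by positivity),
      Nat.cast_sub (show (q + 2) / 2 ≤ (n - 2) / B by omega), Int.natCast_ediv (n - 2) B]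
  · have e : ((q + 2) / 2 + 1) * B = (q + 2) / 2 * B + B := by ring
    omega

theorem stmt8 (q m : ℕ) (hq : IsPrimePow q) (hm : 2 ≤ m) (hme : Even m)
    (r : ℕ) (hr : r = q + 1)
    (δ : ℕ) (hδ : 2 ≤ δ) (hδmax : δ ≤ deltaMax q m) :
    ((⋃ i ∈ Finset.range (δ - 1), coset q (q ^ (2 * m) - 1) (1 + r * i)).ncard : ℤ)
      = Ncal q m δ := by
  subst hr
  have hq2 : 2 ≤ q := hq.two_le
  obtain ⟨h, rfl⟩ : ∃ h, m = 2 * h := by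
    obtain ⟨h, rfl⟩ := hme
    exact ⟨h, by ring⟩
  have hh : 1 ≤ h := by omega
  have hlt := one_add_mul_lt_of_le_deltaMax hq2 hh hδ hδmax
  obtain ⟨B, hB1, hB⟩ := exists_pow_eq hq2 hh
  obtain ⟨n, rfl⟩ : ∃ n, δ = n + 1 := ⟨δ - 1, by omega⟩
  have hmain := ncard_cosetUnion hq2 hh hB1 hB n (Or.inr hlt)
  have hdivlt : (n - 2) / B < q := by
    by_contra hc
    rw [not_lt, Nat.le_div_iff_mul_le hB1] at hc
    have := Nat.mul_le_mul hq2 hB1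
    obtain ⟨k, rfl⟩ : ∃ k, n = k + 2 := ⟨n - 2, by omega⟩
    have h1 : (q + 1) * (q * B + 1) ≤ (q + 1) * (k + 1) := Nat.mul_le_mul_left _ (by omega)
    have h2 : (q + 1) * (q * B + 1) = q * ((q + 1) * B + 1) + 1 := by ring
    have h3 : k + 2 + 1 - 2 = k + 1 := by omega
    rw [hB, h3] at hlt
    omega
  have hdiv : (q ^ (2 * h) - 1) / (q + 1) = B := by
    rw [hB, Nat.add_sub_cancel, Nat.mul_div_cancel_left _ (Nat.succ_pos q)]
  have hiota : (iota q : ℤ) = if Even q ∧ 4 ≤ q then 1 else 0 := rfl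
  have hJ : (q + 2) / 2 * B + 2 ≤ n → Even q → 4 ≤ q := by
    intro h1 h2
    have h3 : (q + 2) / 2 ≤ (n - 2) / B := by
      rw [Nat.le_div_iff_mul_le hB1]
      omega
    obtain ⟨k, hk⟩ := h2
    omega
  have hB2 : ((q + 2) / 2 + 1) * B = (q + 2) / 2 * B + B := by ring
  have hK : n < ((q + 2) / 2 + 1) * B + 2 → (n - 2) / B - (q + 2) / 2 = 0 := by
    intro h1
    have : (n - 2) / B < (q + 2) / 2 + 1 := by
      rw [Nat.div_lt_iff_lt_mul hB1]
      have : 0 < ((q + 2) / 2 + 1) * B := Nat.mul_pos (by omega) hB1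
      omega
    omega
  have hh2 : 2 * h / 2 = h := by omega
  change ((cosetUnion q h n).ncard : ℤ) = _
  rw [hmain]
  unfold Ncal
  rw [istar_eq_s8 hB, hdiv, N1_eq hq2, hiota, hh2]
  have hif : (q + 2) / 2 * B + 2 ≤ n →
      (if (q + 2) / 2 * B + 2 ≤ n ∧ Even q then (1 : ℤ) else 0) =
        if Even q ∧ 4 ≤ q then 1 else 0 := fun h1 =>
    if_congr ⟨fun h2 => ⟨h2.2, hJ h1 h2.2⟩, fun h2 => ⟨h1, h2.1⟩⟩ rfl rfl
  rcases Nat.lt_or_ge n ((q + 2) / 2 * B + 2) with c1 | c1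
  · rw [hK (by omega), if_neg (by omega), if_pos (by omega)]
    push_cast
    ring
  · rw [hif c1, if_neg (show ¬ n + 1 < (q + 2) / 2 * B + 1 + 2 by omega)]
    rcases Nat.lt_or_ge n (((q + 2) / 2 + 1) * B + 2) with c2 | c2
    · rw [hK c2, if_pos (show n + 1 < (q + 2) / 2 * B + 1 + 2 + B by omega)]
      push_cast
      ring
    · rw [if_neg (show ¬ n + 1 < (q + 2) / 2 * B + 1 + 2 + B by omega),
        N2_eq hq2 hB1 hB c2 hdivlt hδmax]
      push_cast
      ring
end

section
/- Let q ∈ {2,3,4} be a prime power, m = 2, and r = q+1. For every integer δ with 2 ≤ δ ≤ (q³−q²+q+3)/(q+1), the cardinality of ∪_{i=0}^{δ−2} C_{1+r·i} (cosets modulo q⁴−1) equals 2·(δ−N₁−1), where N₁ = ⌊(δ−(q+1))/q²⌋ + 1. -/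
/-- Modulo `q ^ 4 - 1` the square of `q ^ 2` is `1`, so a coset has at most two elements. -/
theorem coset_eq_pair (q s : ℕ) (hq : 0 < q) :
    coset q (q ^ 4 - 1) s = {(s : ZMod (q ^ 4 - 1)), (s : ZMod (q ^ 4 - 1)) * q ^ 2} := by
  have h : (q : ZMod (q ^ 4 - 1)) ^ 4 = 1 := by
    have h0 := ZMod.natCast_self (q ^ 4 - 1)
    rw [Nat.cast_sub (Nat.one_le_pow _ _ hq)] at h0
    push_cast at h0
    exact sub_eq_zero.mp h0
  ext x
  simp only [coset, Set.mem_ofPred_eq, Set.mem_insert_iff, Set.mem_singleton_iff]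
  constructor
  · rintro ⟨l, rfl⟩
    obtain ⟨k, rfl | rfl⟩ := Nat.even_or_odd' l
    · left
      rw [show 2 * (2 * k) = 4 * k by ring, pow_mul, h, one_pow, mul_one]
    · right
      rw [show 2 * (2 * k + 1) = 4 * k + 2 by ring, pow_add, pow_mul, h, one_pow, one_mul]
  · rintro (rfl | rfl)
    · exact ⟨0, by simp⟩
    · exact ⟨1, by simp⟩

theorem ncard_biUnion_coset (q r n : ℕ) (hq : 0 < q) :
    (⋃ i ∈ Finset.range n, coset q (q ^ 4 - 1) (1 + r * i)).ncard =
      ((Finset.range n).biUnion fun i =>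
        ({((1 + r * i : ℕ) : ZMod (q ^ 4 - 1)),
          ((1 + r * i : ℕ) : ZMod (q ^ 4 - 1)) * q ^ 2} : Finset (ZMod (q ^ 4 - 1)))).card := by
  rw [← Set.ncard_coe_finset, Finset.coe_biUnion]
  simp only [coset_eq_pair q _ hq, Finset.coe_insert, Finset.coe_singleton, Finset.mem_coe]

theorem stmt9 (q : ℕ) (hq : q = 2 ∨ q = 3 ∨ q = 4)
    (r : ℕ) (hr : r = q + 1)
    (δ : ℕ) (hδ : 2 ≤ δ) (hδmax : δ ≤ (q ^ 3 - q ^ 2 + q + 3) / (q + 1)) :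
    ((⋃ i ∈ Finset.range (δ - 1), coset q (q ^ 4 - 1) (1 + r * i)).ncard : ℤ)
      = 2 * ((δ : ℤ) - N1 q δ - 1) := by
  rw [ncard_biUnion_coset q r _ (by omega)]
  subst hr
  rcases hq with rfl | rfl | rfl <;> norm_num at hδmax <;> interval_cases δ <;> decide +kernel
end
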